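/- Let $\lambda > 0$ and $s, t \geq 0$. Then $$\lim_{H \to (1/2)^{+}} H(2H-1) \int_{0}^{t} \int_{0}^{s} e^{-\lambda(t-u)}\, e^{-\lambda(s-v)}\, |u-v|^{2H-2}\, du\, dv = \frac{1}{2\lambda} \left( e^{-\lambda|t-s|} - e^{-\lambda(t+s)} \right),$$ where the limit is taken as $H$ decreases to $1/2$ from above (with $H \in (1/2,1)$). -/

import Mathlib

open MeasureTheory Real

lemma intervalIntegrable_abs_rpow_zero_of_nonneg {r c : ℝ} (hr : -1 < r) (hc : 0 ≤ c) :
    IntervalIntegrable (fun x : ℝ => |x| ^ r) volume 0 c := by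
  refine (intervalIntegral.intervalIntegrable_rpow' (a := 0) (b := c) hr).congr ?_
  intro x hx
  rw [Set.uIoc_of_le hc] at hx
  simp only [abs_of_pos hx.1]

lemma intervalIntegrable_abs_rpow_zero {r : ℝ} (hr : -1 < r) (c : ℝ) :
    IntervalIntegrable (fun x : ℝ => |x| ^ r) volume 0 c := by
  rcases le_total 0 c with hc | hc
  · exact intervalIntegrable_abs_rpow_zero_of_nonneg hr hc
  · have h := intervalIntegrable_abs_rpow_zero_of_nonneg hr (neg_nonneg.2 hc)
    rw [IntervalIntegrable.iff_comp_neg] at h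
    simpa using h

lemma intervalIntegrable_abs_rpow {r : ℝ} (hr : -1 < r) (a b : ℝ) :
    IntervalIntegrable (fun x : ℝ => |x| ^ r) volume a b :=
  (intervalIntegrable_abs_rpow_zero hr a).symm.trans (intervalIntegrable_abs_rpow_zero hr b)

lemma integral_abs_rpow_zero_of_nonneg {r c : ℝ} (hr : -1 < r) (hc : 0 ≤ c) :
    ∫ x in (0 : ℝ)..c, |x| ^ r = c ^ (r + 1) / (r + 1) := by
  have h : ∫ x in (0 : ℝ)..c, |x| ^ r = ∫ x in (0 : ℝ)..c, x ^ r := by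
    refine intervalIntegral.integral_congr fun x hx => ?_
    rw [Set.uIcc_of_le hc] at hx
    simp only [abs_of_nonneg hx.1]
  rw [h, integral_rpow (Or.inl hr), zero_rpow (by linarith), sub_zero]

lemma integral_abs_rpow_zero {r : ℝ} (hr : -1 < r) (c : ℝ) :
    ∫ x in (0 : ℝ)..c, |x| ^ r = Real.sign c * |c| ^ (r + 1) / (r + 1) := by
  rcases lt_trichotomy c 0 with hc | rfl | hc
  · have h := integral_abs_rpow_zero_of_nonneg hr (neg_nonneg.2 hc.le)
    have h2 := intervalIntegral.integral_comp_neg (a := 0) (b := -c) (fun x : ℝ => |x| ^ r)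
    simp only [abs_neg, neg_neg, neg_zero] at h2
    rw [intervalIntegral.integral_symm, ← h2, h, Real.sign_of_neg hc, abs_of_neg hc]
    ring
  · simp
  · rw [integral_abs_rpow_zero_of_nonneg hr hc.le, Real.sign_of_pos hc, abs_of_pos hc, one_mul]

lemma integrableOn_abs_sub_rpow {r s : ℝ} (hr : -1 < r) (hs : 0 ≤ s) (u : ℝ) :
    IntegrableOn (fun v : ℝ => |u - v| ^ r) (Set.Ioo 0 s) := by
  have h := (intervalIntegrable_abs_rpow hr (u - 0) (u - s)).comp_sub_left u
  simp only [sub_sub_cancel] at h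
  rw [intervalIntegrable_iff_integrableOn_Ioo_of_le hs] at h
  exact h

lemma setIntegral_abs_sub_rpow {r s : ℝ} (hr : -1 < r) (hs : 0 ≤ s) (u : ℝ) :
    ∫ v in Set.Ioo 0 s, |u - v| ^ r =
      (Real.sign u * |u| ^ (r + 1) - Real.sign (u - s) * |u - s| ^ (r + 1)) / (r + 1) := by
  rw [← integral_Ioc_eq_integral_Ioo, ← intervalIntegral.integral_of_le hs,
    intervalIntegral.integral_comp_sub_left (fun x : ℝ => |x| ^ r) u, sub_zero,
    ← intervalIntegral.integral_interval_sub_left (intervalIntegrable_abs_rpow_zero hr u)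
      (intervalIntegrable_abs_rpow_zero hr (u - s)),
    integral_abs_rpow_zero hr, integral_abs_rpow_zero hr, sub_div]

lemma rpow_le_one_add {x a : ℝ} (hx : 0 ≤ x) (ha : 0 ≤ a) (ha1 : a ≤ 1) : x ^ a ≤ 1 + x := by
  rcases le_total x 1 with h | h
  · linarith [rpow_le_one hx h ha]
  · have := rpow_le_rpow_of_exponent_le h ha1
    rw [rpow_one] at this
    linarith

lemma abs_sign_mul_le (c x : ℝ) (hx : 0 ≤ x) : |Real.sign c * x| ≤ x := by
  rcases Real.sign_apply_eq c with h | h | h <;> simp [h, abs_of_nonneg hx, hx]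

lemma abs_mul_setIntegral_le {f : ℝ → ℝ} {H s t u C : ℝ} (hH : 1 / 2 < H) (hH1 : H < 1)
    (hs : 0 ≤ s) (hu : 0 ≤ u) (hut : u ≤ t) (hC : 0 ≤ C)
    (hf : ∀ v ∈ Set.Ioo 0 s, |f v| ≤ C) :
    |H * (2 * H - 1) * ∫ v in Set.Ioo 0 s, f v * |u - v| ^ (2 * H - 2)| ≤
      C * (2 * (1 + t + s)) := by
  have hr : -1 < 2 * H - 2 := by linarith
  have h1 : |∫ v in Set.Ioo 0 s, f v * |u - v| ^ (2 * H - 2)| ≤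
      ∫ v in Set.Ioo 0 s, C * |u - v| ^ (2 * H - 2) := by
    rw [← Real.norm_eq_abs]
    refine norm_integral_le_of_norm_le ((integrableOn_abs_sub_rpow hr hs u).const_mul C) ?_
    filter_upwards [ae_restrict_mem measurableSet_Ioo] with v hv
    rw [norm_mul, Real.norm_eq_abs, Real.norm_eq_abs,
      abs_of_nonneg (rpow_nonneg (abs_nonneg (u - v)) _)]
    exact mul_le_mul_of_nonneg_right (hf v hv) (rpow_nonneg (abs_nonneg _) _)
  rw [integral_const_mul, setIntegral_abs_sub_rpow hr hs] at h1
  have e : 2 * H - 2 + 1 = 2 * H - 1 := by ring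
  rw [e] at h1
  have ha : 0 < 2 * H - 1 := by linarith
  have b1 := rpow_le_one_add (abs_nonneg u) ha.le (by linarith)
  have b2 := rpow_le_one_add (abs_nonneg (u - s)) ha.le (by linarith)
  have c1 := abs_le.1 (abs_sign_mul_le u _ (rpow_nonneg (abs_nonneg u) (2 * H - 1)))
  have c2 := abs_le.1 (abs_sign_mul_le (u - s) _ (rpow_nonneg (abs_nonneg (u - s)) (2 * H - 1)))
  have d1 : |u| ≤ t := by rwa [abs_of_nonneg hu]
  have d2 : |u - s| ≤ t + s := by rw [abs_le]; constructor <;> linarith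
  rw [abs_mul, abs_of_pos (by nlinarith : 0 < H * (2 * H - 1))]
  set A := Real.sign u * |u| ^ (2 * H - 1) - Real.sign (u - s) * |u - s| ^ (2 * H - 1) with hA
  have hA2 : A ≤ 2 * (1 + t + s) := by linarith
  calc _ ≤ H * (2 * H - 1) * (C * (A / (2 * H - 1))) := by gcongr
    _ = C * (H * A * ((2 * H - 1) / (2 * H - 1))) := by ring
    _ = C * (H * A) := by rw [div_self ha.ne', mul_one]
    _ ≤ C * (2 * (1 + t + s)) := by
      refine mul_le_mul_of_nonneg_left ?_ hC
      rcases le_total 0 A with h | h <;> nlinarith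

lemma abs_sub_setIntegral_le {f : ℝ → ℝ} (hfc : Continuous f) {r s u L : ℝ}
    (hr : -1 < r) (hr0 : r ≤ 0) (hs : 0 ≤ s) (hu : 0 ≤ u) (hL : 0 ≤ L)
    (hf : ∀ v ∈ Set.Ioo 0 s, |f v - f u| ≤ L * |u - v|) :
    |(∫ v in Set.Ioo 0 s, f v * |u - v| ^ r) - f u * ∫ v in Set.Ioo 0 s, |u - v| ^ r| ≤
      L * (1 + u + s) * s := by
  have hi := integrableOn_abs_sub_rpow hr hs u
  have hfi : IntegrableOn (fun v => f v * |u - v| ^ r) (Set.Ioo 0 s) := by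
    have h : IntegrableOn (fun v => f v * |u - v| ^ r) (Set.Icc 0 s) :=
      IntegrableOn.continuousOn_mul hfc.continuousOn
        (by rwa [integrableOn_Icc_iff_integrableOn_Ioo]) isCompact_Icc
    exact h.mono_set Set.Ioo_subset_Icc_self
  rw [← integral_const_mul, ← integral_sub hfi (hi.const_mul _), ← Real.norm_eq_abs]
  have h := norm_setIntegral_le_of_norm_le_const (μ := volume) (s := Set.Ioo 0 s)
    (f := fun v => f v * |u - v| ^ r - f u * |u - v| ^ r) (C := L * (1 + u + s))
    (by simp) ?_
  · simpa [hs] using h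
  · intro v hv
    rw [← sub_mul, norm_mul, Real.norm_eq_abs, Real.norm_eq_abs,
      abs_of_nonneg (rpow_nonneg (abs_nonneg (u - v)) _)]
    have hk : |u - v| * |u - v| ^ r ≤ 1 + |u - v| := by
      rcases (abs_nonneg (u - v)).eq_or_lt with h0 | h0
      · simp [← h0]
      · rw [← rpow_one_add' h0.le (by linarith)]
        exact rpow_le_one_add h0.le (by linarith) (by linarith)
    have hd : |u - v| ≤ u + s := by
      rw [abs_le]; constructor <;> linarith [hv.1, hv.2]
    calc |f v - f u| * |u - v| ^ r ≤ L * |u - v| * |u - v| ^ r :=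
          mul_le_mul_of_nonneg_right (hf v hv) (rpow_nonneg (abs_nonneg _) _)
      _ = L * (|u - v| * |u - v| ^ r) := by ring
      _ ≤ L * (1 + u + s) := by gcongr; linarith

lemma tendsto_two_mul_sub_one_half :
    Filter.Tendsto (fun H : ℝ => 2 * H - 1) (nhdsWithin (1 / 2 : ℝ) (Set.Ioi (1 / 2 : ℝ)))
      (nhds 0) := by
  have h : Continuous (fun H : ℝ => 2 * H - 1) := by fun_prop
  have := h.tendsto (1 / 2)
  norm_num at this
  exact tendsto_nhdsWithin_of_tendsto_nhds (by norm_num; exact this)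

lemma tendsto_rpow_two_mul_sub_one {c : ℝ} (hc : c ≠ 0) :
    Filter.Tendsto (fun H : ℝ => |c| ^ (2 * H - 1))
      (nhdsWithin (1 / 2 : ℝ) (Set.Ioi (1 / 2 : ℝ))) (nhds 1) := by
  have := tendsto_const_nhds.rpow tendsto_two_mul_sub_one_half (Or.inl (abs_ne_zero.2 hc))
  rwa [rpow_zero] at this

lemma eventually_half_lt_and_lt_one :
    ∀ᶠ H : ℝ in nhdsWithin (1 / 2 : ℝ) (Set.Ioi (1 / 2 : ℝ)), 1 / 2 < H ∧ H < 1 :=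
  Ioo_mem_nhdsGT (by norm_num)

lemma tendsto_mul_setIntegral_abs_sub_rpow {f : ℝ → ℝ} (hfc : Continuous f) {s u L : ℝ}
    (hs : 0 ≤ s) (hu : 0 < u) (hus : u ≠ s) (hL : 0 ≤ L)
    (hf : ∀ v ∈ Set.Ioo 0 s, |f v - f u| ≤ L * |u - v|) :
    Filter.Tendsto
      (fun H : ℝ => H * (2 * H - 1) * ∫ v in Set.Ioo 0 s, f v * |u - v| ^ (2 * H - 2))
      (nhdsWithin (1 / 2 : ℝ) (Set.Ioi (1 / 2 : ℝ)))
      (nhds (f u * (1 / 2 * (1 - Real.sign (u - s))))) := by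
  have hH : Filter.Tendsto (fun H : ℝ => H) (nhdsWithin (1 / 2 : ℝ) (Set.Ioi (1 / 2 : ℝ)))
      (nhds (1 / 2)) := tendsto_nhdsWithin_of_tendsto_nhds Filter.tendsto_id
  have hmain : Filter.Tendsto (fun H : ℝ => f u * (H * (|u| ^ (2 * H - 1) -
        Real.sign (u - s) * |u - s| ^ (2 * H - 1))))
      (nhdsWithin (1 / 2 : ℝ) (Set.Ioi (1 / 2 : ℝ)))
      (nhds (f u * (1 / 2 * (1 - Real.sign (u - s) * 1)))) :=
    (hH.mul ((tendsto_rpow_two_mul_sub_one hu.ne').sub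
      ((tendsto_rpow_two_mul_sub_one (sub_ne_zero.2 hus)).const_mul _))).const_mul _
  rw [mul_one] at hmain
  refine hmain.congr_dist ?_
  have hbd : Filter.Tendsto (fun H : ℝ => H * (2 * H - 1) * (L * (1 + u + s) * s))
      (nhdsWithin (1 / 2 : ℝ) (Set.Ioi (1 / 2 : ℝ))) (nhds 0) := by
    have := (hH.mul tendsto_two_mul_sub_one_half).mul_const (L * (1 + u + s) * s)
    simpa using this
  refine squeeze_zero' (Filter.Eventually.of_forall fun _ => dist_nonneg) ?_ hbd
  filter_upwards [eventually_half_lt_and_lt_one] with H ⟨h1, h2⟩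
  have hr : -1 < 2 * H - 2 := by linarith
  have ha : 0 < 2 * H - 1 := by linarith
  have key := abs_sub_setIntegral_le hfc hr (by linarith) hs hu.le hL hf
  rw [setIntegral_abs_sub_rpow hr hs, Real.sign_of_pos hu, one_mul,
    show 2 * H - 2 + 1 = 2 * H - 1 by ring] at key
  rw [dist_comm, Real.dist_eq]
  have hp : 0 ≤ H * (2 * H - 1) := by nlinarith
  refine le_trans (le_of_eq ?_) (mul_le_mul_of_nonneg_left key hp)
  rw [← abs_of_nonneg hp, ← abs_mul, abs_of_nonneg hp]
  congr 1
  generalize 2 * H - 1 = a at ha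
  field_simp

lemma abs_exp_sub_exp_le {lam s b u v : ℝ} (hlam : 0 < lam) (hu : u ≤ b) (hv : v ≤ b) :
    |exp (-lam * (s - v)) - exp (-lam * (s - u))| ≤
      lam * exp (-lam * (s - b)) * |u - v| := by
  have hd : ∀ x : ℝ, HasDerivAt (fun x => exp (-lam * (s - x)))
      (exp (-lam * (s - x)) * lam) x := fun x => by
    have := (((hasDerivAt_id x).const_sub s).const_mul (-lam)).exp
    simpa using this
  have := (convex_Iic b).norm_image_sub_le_of_norm_hasDerivWithin_le
    (f := fun x => exp (-lam * (s - x))) (C := lam * exp (-lam * (s - b)))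
    (fun x _ => (hd x).hasDerivWithinAt) (fun x hx => ?_) hu hv
  · simpa [Real.norm_eq_abs, abs_sub_comm u v] using this
  · rw [norm_mul, Real.norm_eq_abs, Real.norm_eq_abs, abs_exp, abs_of_pos hlam, mul_comm]
    have hx' : x ≤ b := hx
    gcongr lam * ?_
    exact exp_le_exp.2 (by nlinarith)

lemma integral_exp_zero {lam s t m : ℝ} (hlam : 0 < lam) :
    ∫ u in (0 : ℝ)..m, exp (-lam * (t - u)) * exp (-lam * (s - u)) =
      1 / (2 * lam) * (exp (-lam * (t + s - 2 * m)) - exp (-lam * (t + s))) := by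
  have hd : ∀ x ∈ Set.uIcc 0 m,
      HasDerivAt (fun x => 1 / (2 * lam) * exp (-lam * (t + s - 2 * x)))
      (exp (-lam * (t - x)) * exp (-lam * (s - x))) x := fun x _ => by
    have := (((((hasDerivAt_id x).const_mul 2).const_sub (t + s)).const_mul
      (-lam)).exp).const_mul (1 / (2 * lam))
    refine this.congr_deriv ?_
    rw [← exp_add, show -lam * (t - x) + -lam * (s - x) = -lam * (t + s - 2 * x) by ring]
    simp only [id]
    field_simp
  rw [intervalIntegral.integral_eq_sub_of_hasDerivAt hd
    (Continuous.intervalIntegrable (by fun_prop) _ _)]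
  simp only [mul_zero, sub_zero]
  ring

lemma integral_exp_mul_half_one_sub_sign {lam s t : ℝ} (hlam : 0 < lam) (hs : 0 ≤ s)
    (ht : 0 ≤ t) :
    ∫ u in Set.Ioo 0 t, exp (-lam * (t - u)) * exp (-lam * (s - u)) *
        (1 / 2 * (1 - Real.sign (u - s))) =
      1 / (2 * lam) * (exp (-lam * |t - s|) - exp (-lam * (t + s))) := by
  have h1 : ∫ u in Set.Ioo 0 t, exp (-lam * (t - u)) * exp (-lam * (s - u)) *
        (1 / 2 * (1 - Real.sign (u - s))) =
      ∫ u in Set.Ioo 0 t, (Set.Iio s).indicator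
        (fun u => exp (-lam * (t - u)) * exp (-lam * (s - u))) u := by
    refine integral_congr_ae (ae_restrict_of_ae ?_)
    filter_upwards [Measure.ae_ne volume s] with u hu
    rcases lt_or_gt_of_ne hu with h | h
    · rw [Set.indicator_of_mem (Set.mem_Iio.2 h), Real.sign_of_neg (sub_neg.2 h)]
      ring
    · rw [Set.indicator_of_notMem (by simpa using h.le), Real.sign_of_pos (sub_pos.2 h)]
      ring
  rw [h1, setIntegral_indicator measurableSet_Iio, Set.Ioo_inter_Iio,
    ← integral_Ioc_eq_integral_Ioo, ← intervalIntegral.integral_of_le (le_min ht hs),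
    integral_exp_zero hlam]
  congr 4
  rcases le_total t s with h | h
  · rw [min_eq_left h, abs_of_nonpos (by linarith)]; ring
  · rw [min_eq_right h, abs_of_nonneg (by linarith)]; ring

theorem stmt8 (lam s t : ℝ) (hlam : 0 < lam) (hs : 0 ≤ s) (ht : 0 ≤ t) :
    Filter.Tendsto
      (fun H : ℝ => H * (2 * H - 1) *
        ∫ u in Set.Ioo (0 : ℝ) t, ∫ v in Set.Ioo (0 : ℝ) s,
          Real.exp (-lam * (t - u)) * Real.exp (-lam * (s - v)) * |u - v| ^ (2 * H - 2))
      (nhdsWithin (1 / 2 : ℝ) (Set.Ioi (1 / 2 : ℝ)))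
      (nhds (1 / (2 * lam) * (Real.exp (-lam * |t - s|) - Real.exp (-lam * (t + s))))) := by
  rw [← integral_exp_mul_half_one_sub_sign hlam hs ht]
  refine Filter.Tendsto.congr (fun H => integral_const_mul _ _) ?_
  refine tendsto_integral_filter_of_dominated_convergence
    (fun _ => 1 * (2 * (1 + t + s))) ?_ ?_ (integrable_const _) ?_
  · refine Filter.Eventually.of_forall fun H => ?_
    refine StronglyMeasurable.aestronglyMeasurable (StronglyMeasurable.const_mul ?_ _)
    refine StronglyMeasurable.integral_prod_right (f := fun u v => Real.exp (-lam * (t - u)) *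
      Real.exp (-lam * (s - v)) * |u - v| ^ (2 * H - 2)) ?_
    refine Measurable.stronglyMeasurable ?_
    simp only [Function.uncurry_def]
    fun_prop
  · filter_upwards [eventually_half_lt_and_lt_one] with H ⟨h1, h2⟩
    filter_upwards [ae_restrict_mem measurableSet_Ioo] with u hu
    refine abs_mul_setIntegral_le h1 h2 hs hu.1.le hu.2.le zero_le_one fun v hv => ?_
    rw [← exp_add, abs_exp, exp_le_one_iff]
    nlinarith [hu.2, hv.2]
  · filter_upwards [ae_restrict_mem measurableSet_Ioo,
      ae_restrict_of_ae (Measure.ae_ne volume s)] with u hu hus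
    have hb := fun v (hv : v ∈ Set.Ioo 0 s) =>
      abs_exp_sub_exp_le (s := s) (b := s + t) (u := u) (v := v) hlam
        (by linarith [hu.2]) (by linarith [hv.2])
    have := (tendsto_mul_setIntegral_abs_sub_rpow (f := fun v => exp (-lam * (s - v)))
      (by fun_prop) hs hu.1 hus (by positivity) hb).const_mul (exp (-lam * (t - u)))
    rw [mul_assoc]
    refine this.congr fun H => ?_
    simp_rw [mul_assoc (exp (-lam * (t - u)))]
    rw [integral_const_mul]
    ring
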